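/- Let 𝐢 = 𝐢₁𝐢₂⋯𝐢_d be the canonical (Chen–Fox–Lyndon) factorization of a word 𝐢 into a non-increasing concatenation of Lyndon words 𝐢₁ ⪰ 𝐢₂ ⪰ ⋯ ⪰ 𝐢_d. Then 𝐢 is dominant if and only if each factor 𝐢_s (s = 1,…,d) is a dominant Lyndon word. -/

import Mathlib

namespace SpinQHA

/-- The coefficient field `ℚ(q)`. -/
abbrev Kq : Type := RatFunc ℚ

/-- The variable `q`. -/
noncomputable def qX : Kq := RatFunc.X

/-- Parity of the letter `i`.  The alphabet is `Fin (n+2)` (so the rank is `n+2 ≥ 2`);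
the index `i` represents the letter `i+1`, and the last letter is the unique odd one. -/
def pa (n : ℕ) (i : Fin (n+2)) : ℕ := if (i : ℕ) = n+1 then 1 else 0

/-- Symmetrized Cartan matrix of `osp(1|2(n+2))`. -/
def cart (n : ℕ) (i j : Fin (n+2)) : ℤ :=
  if i = j then (if (i : ℕ) = n+1 then 2 else 4)
  else if (i : ℕ) + 1 = (j : ℕ) ∨ (j : ℕ) + 1 = (i : ℕ) then -2 else 0

/-- Bilinear form on `Q⁺` (elements recorded by their coordinates). -/
def bil (n : ℕ) (μ ν : Fin (n+2) → ℕ) : ℤ :=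
  ∑ i, ∑ j, (μ i : ℤ) * (ν j : ℤ) * cart n i j

/-- Weight `|w| ∈ Q⁺` of a word. -/
def wt (n : ℕ) (w : List (Fin (n+2))) : Fin (n+2) → ℕ := fun i => w.count i

/-- Parity (as a natural number, read mod 2) of a word. -/
def pw (n : ℕ) (w : List (Fin (n+2))) : ℕ := (w.map (pa n)).sum

/-- `F`, the free `ℚ(q)`-module on the set of words. -/
abbrev F (n : ℕ) : Type := List (Fin (n+2)) →₀ Kq

/-- Quantum shuffle of two words, computed in the "reversed" representation where the
head of each list is the *last* letter of the corresponding word; this encodes the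
inductive rule `(xi) ⋄ (yj) = (x ⋄ (yj))i + (-1)^{p(xi)p(j)} q^{-(|xi|,|j|)} ((xi) ⋄ y)j`. -/
noncomputable def shAux (n : ℕ) : List (Fin (n+2)) → List (Fin (n+2)) → F n
  | [], y => Finsupp.single y 1
  | x, [] => Finsupp.single x 1
  | i :: x, j :: y =>
      Finsupp.mapDomain (List.cons i) (shAux n x (j :: y))
      + ((-1 : Kq) ^ (pw n (i :: x) * pa n j)
          * qX ^ (-(bil n (wt n (i :: x)) (wt n [j])))) •
          Finsupp.mapDomain (List.cons j) (shAux n (i :: x) y)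
  termination_by x y => x.length + y.length

/-- Quantum shuffle product of two words. -/
noncomputable def shw (n : ℕ) (x y : List (Fin (n+2))) : F n :=
  Finsupp.mapDomain List.reverse (shAux n x.reverse y.reverse)

/-- The quantum shuffle product `⋄` on `F`, extended bilinearly. -/
noncomputable def diam (n : ℕ) (u v : F n) : F n :=
  u.sum fun x cx => v.sum fun y cy => (cx * cy) • shw n x y

/-- Strict lexicographic order `≺` on words. -/
def wlt (n : ℕ) (v w : List (Fin (n+2))) : Prop := List.Lex (· < ·) v w

/-- A word is Lyndon if it is nonempty and lexicographically smaller than each of its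
proper nonempty suffixes. -/
def IsLyndonW (n : ℕ) (w : List (Fin (n+2))) : Prop :=
  w ≠ [] ∧ ∀ s t : List (Fin (n+2)), w = s ++ t → s ≠ [] → t ≠ [] → wlt n w t

/-- Iterated shuffle products of one-letter words. -/
noncomputable def prodLetters (n : ℕ) : List (Fin (n+2)) → F n
  | [] => Finsupp.single [] 1
  | i :: l => diam n (Finsupp.single [i] 1) (prodLetters n l)

/-- `U`, the subalgebra of `(F,⋄)` generated by the one-letter words, realized as the
`ℚ(q)`-span of all iterated shuffle products of letters. -/
noncomputable def Ualg (n : ℕ) : Submodule Kq (F n) :=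
  Submodule.span Kq (Set.range (prodLetters n))

/-- `w = max(u)`: `w` is the lexicographically largest word occurring in `u` with
nonzero coefficient. -/
def IsMaxWord (n : ℕ) (u : F n) (w : List (Fin (n+2))) : Prop :=
  w ∈ u.support ∧ ∀ v ∈ u.support, v = w ∨ wlt n v w

/-- A word is dominant if it is the largest word of some `u ∈ U`. -/
def IsDominant (n : ℕ) (w : List (Fin (n+2))) : Prop :=
  ∃ u ∈ Ualg n, IsMaxWord n u w

/-- The commutation factor between two letters. -/
noncomputable def braid (n : ℕ) (i j : Fin (n+2)) : Kq :=
  (-1 : Kq) ^ (pa n i * pa n j) * qX ^ (-(cart n i j))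

/-- The commutation factor between a letter and a word. -/
noncomputable def braidLeft (n : ℕ) (i : Fin (n+2)) (y : List (Fin (n+2))) : Kq :=
  (y.map (braid n i)).prod

/-- The commutation factor between a word and a letter. -/
noncomputable def braidRight (n : ℕ) (x : List (Fin (n+2))) (j : Fin (n+2)) : Kq :=
  (x.map fun i => braid n i j).prod

/-- The commutation factor between two words. -/
noncomputable def braidWord (n : ℕ) (x y : List (Fin (n+2))) : Kq :=
  (x.map fun i => braidLeft n i y).prod

/-- The coefficient of `z` in the quantum shuffle of `x` and `y`, computed from the first
letters. -/
noncomputable def shCoef (n : ℕ) :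
    List (Fin (n+2)) → List (Fin (n+2)) → List (Fin (n+2)) → Kq
  | x, y, [] => if x = [] ∧ y = [] then 1 else 0
  | x, y, k :: z =>
      (match x with
        | [] => 0
        | i :: x' => if i = k then braidLeft n i y * shCoef n x' y z else 0)
      + (match y with
        | [] => 0
        | j :: y' => if j = k then shCoef n x y' z else 0)

section Coefficients

variable {n : ℕ}

lemma qX_ne_zero : qX ≠ 0 := RatFunc.X_ne_zero

lemma braid_ne_zero (i j : Fin (n+2)) : braid n i j ≠ 0 :=
  mul_ne_zero (pow_ne_zero _ (by norm_num)) (zpow_ne_zero _ qX_ne_zero)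

lemma braidLeft_ne_zero (i : Fin (n+2)) (y : List (Fin (n+2))) : braidLeft n i y ≠ 0 := by
  refine List.prod_ne_zero fun h => ?_
  obtain ⟨j, -, hj⟩ := List.mem_map.1 h
  exact braid_ne_zero _ _ hj

lemma braidWord_ne_zero (x y : List (Fin (n+2))) : braidWord n x y ≠ 0 := by
  refine List.prod_ne_zero fun h => ?_
  obtain ⟨j, -, hj⟩ := List.mem_map.1 h
  exact braidLeft_ne_zero _ _ hj

lemma braidLeft_nil (i : Fin (n+2)) : braidLeft n i [] = 1 := rfl

lemma braidLeft_cons (i j : Fin (n+2)) (y : List (Fin (n+2))) :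
    braidLeft n i (j :: y) = braid n i j * braidLeft n i y := by
  simp [braidLeft]

lemma braidLeft_append (i : Fin (n+2)) (x y : List (Fin (n+2))) :
    braidLeft n i (x ++ y) = braidLeft n i x * braidLeft n i y := by
  simp [braidLeft]

lemma braidRight_nil (j : Fin (n+2)) : braidRight n [] j = 1 := rfl

lemma braidRight_cons (i j : Fin (n+2)) (x : List (Fin (n+2))) :
    braidRight n (i :: x) j = braid n i j * braidRight n x j := by
  simp [braidRight]

lemma braidRight_append (x y : List (Fin (n+2))) (j : Fin (n+2)) :
    braidRight n (x ++ y) j = braidRight n x j * braidRight n y j := by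
  simp [braidRight]

lemma braidRight_reverse (x : List (Fin (n+2))) (j : Fin (n+2)) :
    braidRight n x.reverse j = braidRight n x j := by
  simp [braidRight, List.prod_reverse]

lemma braidWord_cons (i : Fin (n+2)) (x y : List (Fin (n+2))) :
    braidWord n (i :: x) y = braidLeft n i y * braidWord n x y := by
  simp [braidWord]

lemma braidWord_append_right (x y z : List (Fin (n+2))) :
    braidWord n x (y ++ z) = braidWord n x y * braidWord n x z := by
  induction x with
  | nil => simp [braidWord]
  | cons i x ih => rw [braidWord_cons, braidWord_cons, braidWord_cons, ih, braidLeft_append]; ring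

lemma bil_wt_singleton (x : List (Fin (n+2))) (j : Fin (n+2)) :
    bil n (wt n x) (wt n [j]) = (x.map fun i => cart n i j).sum := by
  have h : ∀ x : List (Fin (n+2)),
      bil n (wt n x) (wt n [j]) = ∑ i, (x.count i : ℤ) * cart n i j := by
    intro x
    refine Finset.sum_congr rfl fun i _ => ?_
    rw [Finset.sum_eq_single j]
    · simp [wt]
    · intro b _ hb
      simp [wt, hb.symm]
    · simp
  rw [h]
  induction x with
  | nil => simp
  | cons i x ih =>
    simp only [List.count_cons, List.map_cons, List.sum_cons, ← ih]
    push_cast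
    simp only [add_mul, Finset.sum_add_distrib]
    rw [add_comm]
    congr 1
    rw [Finset.sum_eq_single i]
    · simp
    · intro b _ hb
      simp [hb.symm]
    · simp

lemma shuffle_factor_eq (x : List (Fin (n+2))) (j : Fin (n+2)) :
    (-1 : Kq) ^ (pw n x * pa n j) * qX ^ (-(bil n (wt n x) (wt n [j]))) = braidRight n x j := by
  rw [bil_wt_singleton]
  induction x with
  | nil => simp [pw, braidRight]
  | cons i x ih =>
    rw [braidRight_cons, ← ih, braid]
    simp only [pw, List.map_cons, List.sum_cons, add_mul, pow_add, neg_add]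
    rw [zpow_add₀ qX_ne_zero]
    ring

lemma shCoef_nil_left (y z : List (Fin (n+2))) :
    shCoef n [] y z = if y = z then 1 else 0 := by
  induction z generalizing y with
  | nil => simp [shCoef]
  | cons k z ih =>
    cases y with
    | nil => simp [shCoef]
    | cons j y => simp [shCoef, ih, ite_and]

lemma shCoef_nil_right (x z : List (Fin (n+2))) :
    shCoef n x [] z = if x = z then 1 else 0 := by
  induction z generalizing x with
  | nil => simp [shCoef]
  | cons k z ih =>
    cases x with
    | nil => simp [shCoef]
    | cons j y => simp [shCoef, ih, ite_and, braidLeft_nil]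

lemma shCoef_cons_cons (i j k : Fin (n+2)) (x y z : List (Fin (n+2))) :
    shCoef n (i :: x) (j :: y) (k :: z) =
      (if i = k then braidLeft n i (j :: y) * shCoef n x (j :: y) z else 0)
      + (if j = k then shCoef n (i :: x) y z else 0) := by
  rw [shCoef]

lemma shCoef_concat_concat (i j k : Fin (n+2)) (x y z : List (Fin (n+2))) :
    shCoef n (x ++ [i]) (y ++ [j]) (z ++ [k]) =
      (if i = k then shCoef n x (y ++ [j]) z else 0)
      + (if j = k then braidRight n (x ++ [i]) j * shCoef n (x ++ [i]) y z else 0) := by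
  have concat_eq : ∀ (a : Fin (n+2)) (v : List (Fin (n+2))) (b : Fin (n+2)) z,
      (a :: (v ++ [b]) = z ++ [k]) ↔ (a :: v = z ∧ b = k) := fun a v b z => by
    rw [← List.cons_append]
    exact ⟨fun h => ⟨(List.append_inj' h rfl).1, by simpa using (List.append_inj' h rfl).2⟩,
      fun h => by rw [h.1, h.2]⟩
  induction z generalizing x y with
  | nil =>
    rcases x with _ | ⟨a, x⟩ <;> rcases y with _ | ⟨b, y⟩ <;> simp [shCoef]
  | cons m z ih =>
    rcases x with _ | ⟨a, x⟩ <;> rcases y with _ | ⟨b, y⟩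
    · simp only [List.nil_append, List.cons_append, shCoef_cons_cons, shCoef_nil_left,
        shCoef_nil_right, braidLeft_cons, braidLeft_nil, braidRight_cons, braidRight_nil]
      rcases z with _ | ⟨c, z⟩
      · simp only [List.nil_append, List.cons.injEq, and_true]
        split_ifs <;> ring
      · simp
    · have h1 := ih [] y
      simp only [List.nil_append] at h1 ⊢
      simp only [List.cons_append, shCoef_cons_cons, shCoef_nil_left, h1, concat_eq, ite_and,
        braidLeft_cons, braidLeft_append, braidRight_cons, braidRight_nil, braidLeft_nil,
        List.cons.injEq]
      split_ifs <;> ring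
    · have h1 := ih x []
      simp only [List.nil_append] at h1 ⊢
      simp only [List.cons_append, shCoef_cons_cons, shCoef_nil_right, h1, concat_eq, ite_and,
        braidLeft_cons, braidRight_append, braidRight_cons, braidRight_nil, braidLeft_nil,
        List.cons.injEq]
      split_ifs <;> ring
    · have h1 := ih x (b :: y)
      have h2 := ih (a :: x) y
      simp only [List.cons_append] at h1 h2 ⊢
      simp only [shCoef_cons_cons, h1, h2, braidLeft_cons, braidLeft_append,
        braidRight_append, braidRight_cons, braidLeft_nil]
      split_ifs <;> ring

lemma mapDomain_cons_apply (i k : Fin (n+2)) (f : F n) (z : List (Fin (n+2))) :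
    Finsupp.mapDomain (List.cons i) f (k :: z) = if i = k then f z else 0 := by
  split_ifs with h
  · subst h
    exact Finsupp.mapDomain_apply (List.cons_injective) f z
  · refine Finsupp.mapDomain_of_notMem_range _ _ ?_
    rintro ⟨w, hw⟩
    exact h (List.cons.inj hw).1

lemma mapDomain_cons_apply_nil (i : Fin (n+2)) (f : F n) :
    Finsupp.mapDomain (List.cons i) f [] = 0 := by
  refine Finsupp.mapDomain_of_notMem_range _ _ ?_
  rintro ⟨w, hw⟩
  exact List.cons_ne_nil _ _ hw

lemma shAux_apply (x y z : List (Fin (n+2))) :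
    shAux n x y z = shCoef n x.reverse y.reverse z.reverse := by
  induction z generalizing x y with
  | nil =>
    rcases x with _ | ⟨i, x⟩ <;> rcases y with _ | ⟨j, y⟩ <;>
      simp [shAux, shCoef, mapDomain_cons_apply_nil]
  | cons k z ih =>
    rcases x with _ | ⟨i, x⟩
    · rw [shAux, List.reverse_nil, shCoef_nil_left, Finsupp.single_apply]
      simp only [List.reverse_inj]
    · rcases y with _ | ⟨j, y⟩
      · rw [shAux, List.reverse_nil, shCoef_nil_right, Finsupp.single_apply]
        · simp only [List.reverse_inj]
        · simp
      · have h1 := ih x (j :: y)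
        have h2 := ih (i :: x) y
        rw [shAux, shuffle_factor_eq]
        simp only [List.reverse_cons] at h1 h2 ⊢
        rw [shCoef_concat_concat, Finsupp.add_apply, Finsupp.smul_apply, mapDomain_cons_apply,
          mapDomain_cons_apply, h1, h2, ← List.reverse_cons, ← List.reverse_cons,
          braidRight_reverse]
        simp

lemma shw_apply (x y z : List (Fin (n+2))) : shw n x y z = shCoef n x y z := by
  have h := Finsupp.mapDomain_apply List.reverse_injective
    (shAux n x.reverse y.reverse) z.reverse
  rw [List.reverse_reverse, shAux_apply] at h
  simp only [List.reverse_reverse] at h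
  exact h

end Coefficients

/-- The quantum shuffle product as a bilinear map. -/
noncomputable def shuffle (n : ℕ) : F n →ₗ[Kq] F n →ₗ[Kq] F n :=
  Finsupp.linearCombination Kq fun x => Finsupp.linearCombination Kq (shw n x)

/-- Removal of a first letter `k`. -/
noncomputable def removeFirst (n : ℕ) (k : Fin (n+2)) : F n →ₗ[Kq] F n :=
  Finsupp.lcomapDomain (List.cons k) List.cons_injective

/-- Removal of a last letter `k`. -/
noncomputable def removeLast (n : ℕ) (k : Fin (n+2)) : F n →ₗ[Kq] F n :=
  Finsupp.lcomapDomain (fun z => z ++ [k]) (List.append_left_injective [k])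

/-- Multiplication of each word by its commutation factor with the letter `k`. -/
noncomputable def twist (n : ℕ) (k : Fin (n+2)) : F n →ₗ[Kq] F n :=
  Finsupp.linearCombination Kq fun x => Finsupp.single x (braidLeft n k x)

section Algebra

variable {n : ℕ}

lemma shuffle_single (x y : List (Fin (n+2))) (a b : Kq) :
    shuffle n (Finsupp.single x a) (Finsupp.single y b) = (a * b) • shw n x y := by
  simp [shuffle, Finsupp.linearCombination_single, mul_smul]

lemma diam_eq_shuffle (u v : F n) : diam n u v = shuffle n u v := by
  rw [diam, shuffle, Finsupp.linearCombination_apply, Finsupp.sum, Finsupp.sum,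
    LinearMap.sum_apply]
  refine Finset.sum_congr rfl fun x _ => ?_
  rw [LinearMap.smul_apply, Finsupp.linearCombination_apply, Finsupp.smul_sum]
  exact Finset.sum_congr rfl fun y _ => mul_smul _ _ _

lemma shuffle_apply (u v : F n) (z : List (Fin (n+2))) :
    shuffle n u v z = u.sum fun x a => v.sum fun y b => a * b * shCoef n x y z := by
  rw [← diam_eq_shuffle, diam, Finsupp.sum, Finsupp.finsetSum_apply]
  refine Finset.sum_congr rfl fun x _ => ?_
  rw [Finsupp.sum, Finsupp.finsetSum_apply]
  refine Finset.sum_congr rfl fun y _ => ?_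
  rw [Finsupp.smul_apply, shw_apply, smul_eq_mul]

lemma removeFirst_apply (k : Fin (n+2)) (f : F n) (z : List (Fin (n+2))) :
    removeFirst n k f z = f (k :: z) := rfl

lemma removeLast_apply (k : Fin (n+2)) (f : F n) (z : List (Fin (n+2))) :
    removeLast n k f z = f (z ++ [k]) := rfl

lemma twist_single (k : Fin (n+2)) (x : List (Fin (n+2))) (a : Kq) :
    twist n k (Finsupp.single x a) = Finsupp.single x (braidLeft n k x * a) := by
  simp [twist, Finsupp.linearCombination_single, mul_comm]

lemma twist_apply (k : Fin (n+2)) (f : F n) (z : List (Fin (n+2))) :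
    twist n k f z = braidLeft n k z * f z := by
  induction f using Finsupp.induction_linear with
  | zero => simp
  | add f g hf hg => rw [map_add, Finsupp.add_apply, hf, hg, Finsupp.add_apply, mul_add]
  | single x a =>
    rw [twist_single, Finsupp.single_apply, Finsupp.single_apply]
    split_ifs with h <;> simp [h]

lemma removeFirst_single_nil (k : Fin (n+2)) (a : Kq) :
    removeFirst n k (Finsupp.single [] a) = 0 := by
  ext z
  simp [removeFirst_apply]

lemma removeFirst_single_cons (k i : Fin (n+2)) (x : List (Fin (n+2))) (a : Kq) :
    removeFirst n k (Finsupp.single (i :: x) a) = if i = k then Finsupp.single x a else 0 := by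
  ext z
  rw [removeFirst_apply, Finsupp.single_apply]
  split_ifs <;> simp_all

lemma removeLast_single_nil (k : Fin (n+2)) (a : Kq) :
    removeLast n k (Finsupp.single [] a) = 0 := by
  ext z
  simp [removeLast_apply]

lemma removeLast_single_concat (k i : Fin (n+2)) (x : List (Fin (n+2))) (a : Kq) :
    removeLast n k (Finsupp.single (x ++ [i]) a) = if i = k then Finsupp.single x a else 0 := by
  ext z
  have h : (x ++ [i] = z ++ [k]) ↔ (x = z ∧ i = k) :=
    ⟨fun h => ⟨(List.append_inj' h rfl).1, by simpa using (List.append_inj' h rfl).2⟩,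
      fun h => by rw [h.1, h.2]⟩
  rw [removeLast_apply, Finsupp.single_apply]
  split_ifs <;> simp_all

lemma shuffle_one_left (v : F n) : shuffle n (Finsupp.single [] 1) v = v := by
  induction v using Finsupp.induction_linear with
  | zero => simp
  | add f g hf hg => rw [map_add, hf, hg]
  | single x a =>
    ext z
    rw [shuffle_single, Finsupp.smul_apply, shw_apply, shCoef_nil_left, Finsupp.single_apply]
    simp

lemma shuffle_apply_nil (u v : F n) : shuffle n u v [] = u [] * v [] := by
  induction u using Finsupp.induction_linear with
  | zero => simp
  | add f g hf hg =>
    rw [map_add, LinearMap.add_apply, Finsupp.add_apply, Finsupp.add_apply, hf, hg, add_mul]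
  | single x a =>
    induction v using Finsupp.induction_linear with
    | zero => simp
    | add f g hf hg => rw [map_add, Finsupp.add_apply, Finsupp.add_apply, hf, hg, mul_add]
    | single y b =>
      rw [shuffle_single, Finsupp.smul_apply, shw_apply, shCoef, Finsupp.single_apply,
        Finsupp.single_apply]
      split_ifs <;> simp_all

lemma removeFirst_shuffle (k : Fin (n+2)) (u v : F n) :
    removeFirst n k (shuffle n u v) =
      shuffle n (removeFirst n k u) (twist n k v) + shuffle n u (removeFirst n k v) := by
  induction u using Finsupp.induction_linear with
  | zero => simp
  | add f g hf hg => simp only [map_add, LinearMap.add_apply, hf, hg]; abel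
  | single x a =>
    induction v using Finsupp.induction_linear with
    | zero => simp
    | add f g hf hg => simp only [map_add, hf, hg]; abel
    | single y b =>
      ext z
      rw [shuffle_single, removeFirst_apply, Finsupp.smul_apply, shw_apply, twist_single]
      rcases x with _ | ⟨i, x⟩ <;> rcases y with _ | ⟨j, y⟩ <;>
        simp only [removeFirst_single_nil, removeFirst_single_cons, shCoef]
      · simp
      · split_ifs <;> simp [shuffle_single, shw_apply]
      · split_ifs with h
        · simp [shuffle_single, shw_apply, h, -Finsupp.single_mul]
          ring
        · simp
      · split_ifs with h1 h2 h2 <;>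
          simp [shuffle_single, shw_apply, h1, h2, -Finsupp.single_mul] <;> ring

lemma removeLast_letter_shuffle (k i : Fin (n+2)) (v : F n) :
    removeLast n k (shuffle n (Finsupp.single [i] 1) v) =
      (if i = k then v else 0)
      + braid n i k • shuffle n (Finsupp.single [i] 1) (removeLast n k v) := by
  induction v using Finsupp.induction_linear with
  | zero => simp
  | add f g hf hg =>
    simp only [map_add, hf, hg, smul_add]
    split_ifs
    · abel
    · simp
  | single y b =>
    ext z
    rw [shuffle_single, removeLast_apply, Finsupp.smul_apply, shw_apply]
    rcases List.eq_nil_or_concat y with rfl | ⟨y, j, rfl⟩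
    · have h : ([i] = z ++ [k]) ↔ ([] = z ∧ i = k) :=
        ⟨fun h => ⟨(List.append_inj' (s₁ := []) h rfl).1,
          by simpa using (List.append_inj' (s₁ := []) h rfl).2⟩, fun h => by rw [← h.1, h.2]; rfl⟩
      simp only [removeLast_single_nil, shCoef_nil_right, h]
      split_ifs <;> simp_all
    · rw [List.concat_eq_append, removeLast_single_concat]
      have h := shCoef_concat_concat i j k [] y z
      simp only [List.nil_append, shCoef_nil_left] at h
      rw [h, braidRight_cons, braidRight_nil]
      split_ifs with h1 h2 h2 <;>
        simp_all [shuffle_single, shw_apply] <;> ring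

lemma removeFirst_twist (k m : Fin (n+2)) (f : F n) :
    removeFirst n m (twist n k f) = braid n k m • twist n k (removeFirst n m f) := by
  ext z
  simp [removeFirst_apply, twist_apply, braidLeft_cons, mul_assoc]

lemma twist_comm (k m : Fin (n+2)) (f : F n) :
    twist n m (twist n k f) = twist n k (twist n m f) := by
  ext z
  simp only [twist_apply]
  ring

lemma twist_shuffle (k : Fin (n+2)) (u v : F n) :
    twist n k (shuffle n u v) = shuffle n (twist n k u) (twist n k v) := by
  ext z
  induction z generalizing u v with
  | nil => simp [twist_apply, shuffle_apply_nil, braidLeft_nil]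
  | cons m z ih =>
    rw [← removeFirst_apply, ← removeFirst_apply, removeFirst_twist, removeFirst_shuffle,
      removeFirst_shuffle, removeFirst_twist, removeFirst_twist, map_add, Finsupp.smul_apply,
      Finsupp.add_apply, ih, ih, twist_comm m k]
    simp [mul_add]

lemma shuffle_assoc (u v w : F n) :
    shuffle n (shuffle n u v) w = shuffle n u (shuffle n v w) := by
  ext z
  induction z generalizing u v w with
  | nil => simp [shuffle_apply_nil, mul_assoc]
  | cons m z ih =>
    rw [← removeFirst_apply, ← removeFirst_apply]
    simp only [removeFirst_shuffle, twist_shuffle, map_add, LinearMap.add_apply,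
      Finsupp.add_apply, ih]
    ring

lemma letter_shuffle_mem_Ualg (i : Fin (n+2)) {u : F n} (hu : u ∈ Ualg n) :
    shuffle n (Finsupp.single [i] 1) u ∈ Ualg n := by
  induction hu using Submodule.span_induction with
  | mem x hx =>
    obtain ⟨l, rfl⟩ := hx
    refine Submodule.subset_span ⟨i :: l, ?_⟩
    rw [prodLetters, diam_eq_shuffle]
  | zero => simp
  | add x y _ _ hx hy => rw [map_add]; exact add_mem hx hy
  | smul a x _ hx => rw [map_smul]; exact Submodule.smul_mem _ _ hx

lemma prodLetters_mem_Ualg (l : List (Fin (n+2))) : prodLetters n l ∈ Ualg n :=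
  Submodule.subset_span ⟨l, rfl⟩

lemma map_mem_Ualg {φ : F n →ₗ[Kq] F n} (h : ∀ l, φ (prodLetters n l) ∈ Ualg n) {u : F n}
    (hu : u ∈ Ualg n) : φ u ∈ Ualg n := by
  have : Ualg n ≤ (Ualg n).comap φ := by
    refine Submodule.span_le.2 ?_
    rintro _ ⟨l, rfl⟩
    exact h l
  exact this hu

lemma shuffle_mem_Ualg {u v : F n} (hu : u ∈ Ualg n) (hv : v ∈ Ualg n) :
    shuffle n u v ∈ Ualg n := by
  refine map_mem_Ualg (φ := (shuffle n).flip v) (fun l => ?_) hu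
  rw [LinearMap.flip_apply]
  induction l with
  | nil => rwa [prodLetters, shuffle_one_left]
  | cons i l ih =>
    rw [prodLetters, diam_eq_shuffle, shuffle_assoc]
    exact letter_shuffle_mem_Ualg i ih

lemma twist_prodLetters (k : Fin (n+2)) (l : List (Fin (n+2))) :
    twist n k (prodLetters n l) = braidLeft n k l • prodLetters n l := by
  induction l with
  | nil => rw [prodLetters, twist_single, braidLeft_nil, one_mul, one_smul]
  | cons i l ih =>
    have h : twist n k (Finsupp.single [i] 1) = braid n k i • Finsupp.single [i] 1 := by
      rw [twist_single, braidLeft_cons, braidLeft_nil, mul_one, Finsupp.smul_single, smul_eq_mul]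
    rw [prodLetters, diam_eq_shuffle, twist_shuffle, ih, h, braidLeft_cons, map_smul, map_smul,
      LinearMap.smul_apply, smul_smul, mul_comm]

lemma removeFirst_mem_Ualg (k : Fin (n+2)) {u : F n} (hu : u ∈ Ualg n) :
    removeFirst n k u ∈ Ualg n := by
  refine map_mem_Ualg (fun l => ?_) hu
  induction l with
  | nil => rw [prodLetters, removeFirst_single_nil]; exact zero_mem _
  | cons i l ih =>
    rw [prodLetters, diam_eq_shuffle, removeFirst_shuffle, twist_prodLetters,
      removeFirst_single_cons]
    refine add_mem ?_ (letter_shuffle_mem_Ualg i ih)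
    split_ifs
    · rw [shuffle_one_left]
      exact Submodule.smul_mem _ _ (prodLetters_mem_Ualg l)
    · simp

lemma removeLast_mem_Ualg (k : Fin (n+2)) {u : F n} (hu : u ∈ Ualg n) :
    removeLast n k u ∈ Ualg n := by
  refine map_mem_Ualg (fun l => ?_) hu
  induction l with
  | nil => rw [prodLetters, removeLast_single_nil]; exact zero_mem _
  | cons i l ih =>
    rw [prodLetters, diam_eq_shuffle, removeLast_letter_shuffle]
    refine add_mem ?_ (Submodule.smul_mem _ _ (letter_shuffle_mem_Ualg i ih))
    split_ifs
    · exact prodLetters_mem_Ualg l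
    · exact zero_mem _

lemma length_eq_of_shCoef_ne_zero {x y z : List (Fin (n+2))} (h : shCoef n x y z ≠ 0) :
    z.length = x.length + y.length := by
  induction z generalizing x y with
  | nil =>
    rw [shCoef] at h
    split_ifs at h with h'
    · simp [h'.1, h'.2]
    · exact absurd rfl h
  | cons k z ih =>
    rcases x with _ | ⟨i, x⟩
    · rw [shCoef_nil_left] at h
      simp [← of_not_not (mt (if_neg (α := Kq)) h)]
    rcases y with _ | ⟨j, y⟩
    · rw [shCoef_nil_right] at h
      simp [← of_not_not (mt (if_neg (α := Kq)) h)]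
    rw [shCoef_cons_cons] at h
    by_contra hne
    simp only [List.length_cons] at hne
    refine h ?_
    rw [not_imp_comm.1 (@ih x (j :: y)) (by simp; omega),
      not_imp_comm.1 (@ih (i :: x) y) (by simp; omega)]
    simp

lemma length_eq_of_prodLetters_ne_zero {l z : List (Fin (n+2))} (h : prodLetters n l z ≠ 0) :
    z.length = l.length := by
  induction l generalizing z with
  | nil =>
    rw [prodLetters, Finsupp.single_apply] at h
    split_ifs at h with h'
    · rw [h']
    · exact absurd rfl h
  | cons i l ih =>
    rw [prodLetters, diam_eq_shuffle, shuffle_apply, Finsupp.sum_single_index (by simp)] at h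
    obtain ⟨y, hy, hne⟩ := Finset.exists_ne_zero_of_sum_ne_zero h
    rw [length_eq_of_shCoef_ne_zero (right_ne_zero_of_mul hne), ih (Finsupp.mem_support_iff.1 hy),
      List.length_singleton, List.length_cons, add_comm]

/-- Projection on the words of a given length. -/
noncomputable def lengthPart (n N : ℕ) : F n →ₗ[Kq] F n :=
  (Finsupp.supported Kq Kq {z : List (Fin (n+2)) | z.length = N}).subtype ∘ₗ
    Finsupp.restrictDom Kq Kq {z : List (Fin (n+2)) | z.length = N}

lemma lengthPart_apply (N : ℕ) (f : F n) (z : List (Fin (n+2))) :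
    lengthPart n N f z = if z.length = N then f z else 0 := by
  simp [lengthPart, Finsupp.filter_apply]

lemma lengthPart_mem_Ualg (N : ℕ) {u : F n} (hu : u ∈ Ualg n) : lengthPart n N u ∈ Ualg n := by
  refine map_mem_Ualg (fun l => ?_) hu
  by_cases h : l.length = N
  · convert prodLetters_mem_Ualg l using 1
    ext z
    rw [lengthPart_apply, ite_eq_left_iff]
    intro hz
    by_contra h0
    exact hz ((length_eq_of_prodLetters_ne_zero (Ne.symm h0)).trans h)
  · convert zero_mem (Ualg n) using 1
    ext z
    rw [lengthPart_apply, Finsupp.zero_apply, ite_eq_right_iff]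
    intro hz
    by_contra h0
    exact h ((length_eq_of_prodLetters_ne_zero h0).symm.trans hz)

end Algebra

/-- The discount factor used to encode words by rational numbers. -/
def discount (n : ℕ) : ℚ := 1 / (n + 4)

/-- The number with digits the letters of a word; it encodes the lexicographic order. -/
def wordVal (n : ℕ) : List (Fin (n+2)) → ℚ
  | [] => 0
  | i :: x => ((i : ℕ) + 1) + discount n * wordVal n x

section WordVal

variable {n : ℕ}

lemma discount_pos : 0 < discount n := by
  unfold discount
  positivity

lemma discount_lt_one : discount n < 1 := by
  unfold discount
  rw [div_lt_one (by positivity)]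
  have : (0 : ℚ) ≤ n := Nat.cast_nonneg n
  linarith

lemma wordVal_nonneg (x : List (Fin (n+2))) : 0 ≤ wordVal n x := by
  induction x with
  | nil => exact le_rfl
  | cons i x ih =>
    have := mul_nonneg (discount_pos (n := n)).le ih
    rw [wordVal]
    positivity

lemma discount_mul_wordVal_lt_one (x : List (Fin (n+2))) : discount n * wordVal n x < 1 := by
  have hd : discount n * (n + 4) = 1 := by
    unfold discount
    field_simp
  induction x with
  | nil => simp [wordVal]
  | cons i x ih =>
    have hi : ((i : ℕ) : ℚ) ≤ n + 1 := by exact_mod_cast Nat.lt_succ_iff.1 i.2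
    rw [wordVal, ← hd]
    exact mul_lt_mul_of_pos_left (by linarith) discount_pos

lemma wordVal_cons_pos (i : Fin (n+2)) (x : List (Fin (n+2))) : 0 < wordVal n (i :: x) := by
  have := mul_nonneg (discount_pos (n := n)).le (wordVal_nonneg x)
  rw [wordVal]
  positivity

lemma wordVal_cons_lt_cons_of_lt {i j : Fin (n+2)} (h : i < j) (x y : List (Fin (n+2))) :
    wordVal n (i :: x) < wordVal n (j :: y) := by
  have h1 : ((i : ℕ) : ℚ) + 1 ≤ (j : ℕ) := by exact_mod_cast h
  have h2 := discount_mul_wordVal_lt_one x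
  have h3 := mul_nonneg (discount_pos (n := n)).le (wordVal_nonneg y)
  rw [wordVal, wordVal]
  linarith

lemma wordVal_cons_lt_cons_iff (i : Fin (n+2)) (x y : List (Fin (n+2))) :
    wordVal n (i :: x) < wordVal n (i :: y) ↔ wordVal n x < wordVal n y := by
  rw [wordVal, wordVal, add_lt_add_iff_left, mul_lt_mul_iff_right₀ discount_pos]

lemma wordVal_cons_le_cons_iff (i : Fin (n+2)) (x y : List (Fin (n+2))) :
    wordVal n (i :: x) ≤ wordVal n (i :: y) ↔ wordVal n x ≤ wordVal n y := by
  rw [← not_lt, wordVal_cons_lt_cons_iff, not_lt]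

lemma wlt_iff_wordVal_lt (x y : List (Fin (n+2))) : wlt n x y ↔ wordVal n x < wordVal n y := by
  unfold wlt
  induction x generalizing y with
  | nil =>
    rcases y with _ | ⟨j, y⟩
    · simp [wordVal]
    · simp only [wordVal_cons_pos j y, wordVal.eq_1 n, iff_true]
      exact List.Lex.nil
  | cons i x ih =>
    rcases y with _ | ⟨j, y⟩
    · simp only [List.not_lex_nil, false_iff, not_lt]
      exact (wordVal_cons_pos i x).le
    · rw [List.cons_lex_cons_iff]
      rcases lt_trichotomy i j with h | rfl | h
      · simp [h, wordVal_cons_lt_cons_of_lt h]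
      · simp [ih, wordVal_cons_lt_cons_iff]
      · simp [h.not_gt, h.ne', (wordVal_cons_lt_cons_of_lt h y x).not_gt]

lemma wordVal_injective : Function.Injective (wordVal n) := by
  intro x y h
  induction x generalizing y with
  | nil =>
    rcases y with _ | ⟨j, y⟩
    · rfl
    · exact absurd h (wordVal_cons_pos j y).ne
  | cons i x ih =>
    rcases y with _ | ⟨j, y⟩
    · exact absurd h (wordVal_cons_pos i x).ne'
    · rcases lt_trichotomy i j with hij | rfl | hij
      · exact absurd h (wordVal_cons_lt_cons_of_lt hij x y).ne
      · rw [ih (le_antisymm ((wordVal_cons_le_cons_iff i x y).1 h.le)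
          ((wordVal_cons_le_cons_iff i y x).1 h.ge))]
      · exact absurd h (wordVal_cons_lt_cons_of_lt hij y x).ne'

lemma eq_or_wlt_iff (x y : List (Fin (n+2))) :
    (x = y ∨ wlt n x y) ↔ wordVal n x ≤ wordVal n y := by
  rw [wlt_iff_wordVal_lt, le_iff_eq_or_lt, wordVal_injective.eq_iff]

lemma wordVal_append (x y : List (Fin (n+2))) :
    wordVal n (x ++ y) = wordVal n x + discount n ^ x.length * wordVal n y := by
  induction x with
  | nil => simp [wordVal]
  | cons i x ih =>
    rw [List.cons_append, wordVal, ih, wordVal, List.length_cons]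
    ring

lemma wordVal_append_lt_append {x y : List (Fin (n+2))} (h : wordVal n x < wordVal n y)
    (hp : ¬ x <+: y) (u v : List (Fin (n+2))) : wordVal n (x ++ u) < wordVal n (y ++ v) := by
  induction x generalizing y with
  | nil => exact absurd List.nil_prefix hp
  | cons i x ih =>
    rcases y with _ | ⟨j, y⟩
    · exact absurd h (wordVal_cons_pos i x).not_gt
    · rcases lt_trichotomy i j with hij | rfl | hij
      · exact wordVal_cons_lt_cons_of_lt hij _ _
      · rw [List.cons_append, List.cons_append, wordVal_cons_lt_cons_iff]
        refine ih ((wordVal_cons_lt_cons_iff i x y).1 h) fun hp' => hp ?_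
        exact (List.cons_prefix_cons).2 ⟨rfl, hp'⟩
      · exact absurd h (wordVal_cons_lt_cons_of_lt hij y x).not_gt

lemma wordVal_append_lt_append_of_length_le {x y : List (Fin (n+2))}
    (h : wordVal n x < wordVal n y) (hl : y.length ≤ x.length) (u v : List (Fin (n+2))) :
    wordVal n (x ++ u) < wordVal n (y ++ v) :=
  wordVal_append_lt_append h (fun hp => h.ne (by rw [hp.eq_of_length_le hl])) u v

lemma wordVal_le_of_append_le_append {a x y b : List (Fin (n+2))} (hl : x.length = y.length)
    (h : wordVal n (a ++ x ++ b) ≤ wordVal n (a ++ y ++ b)) : wordVal n x ≤ wordVal n y := by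
  by_contra! hlt
  have := wordVal_append_lt_append_of_length_le hlt hl.le b b
  refine h.not_gt ?_
  rw [List.append_assoc, List.append_assoc, wordVal_append, wordVal_append a]
  exact add_lt_add_right (mul_lt_mul_of_pos_left this (pow_pos discount_pos _)) _

/-- The value per unit of discounted time of a word. -/
def wordIndex (n : ℕ) (x : List (Fin (n+2))) : ℚ := wordVal n x / (1 - discount n ^ x.length)

lemma one_sub_discount_pow_pos {k : ℕ} (hk : k ≠ 0) : 0 < 1 - discount n ^ k :=
  sub_pos.2 (pow_lt_one₀ discount_pos.le discount_lt_one hk)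

lemma one_sub_discount_pow_nonneg (k : ℕ) : 0 ≤ 1 - discount n ^ k :=
  sub_nonneg.2 (pow_le_one₀ discount_pos.le discount_lt_one.le)

lemma wordIndex_mul {x : List (Fin (n+2))} (hx : x ≠ []) :
    wordIndex n x * (1 - discount n ^ x.length) = wordVal n x :=
  div_mul_cancel₀ _ (one_sub_discount_pow_pos (by simpa using hx)).ne'

lemma wordIndex_lt_of_append_lt {x y : List (Fin (n+2))} (hx : x ≠ []) (hy : y ≠ [])
    (h : wordVal n (x ++ y) < wordVal n (y ++ x)) : wordIndex n x < wordIndex n y := by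
  rw [wordVal_append, wordVal_append] at h
  rw [wordIndex, wordIndex, div_lt_div_iff₀ (one_sub_discount_pow_pos (by simpa using hx))
    (one_sub_discount_pow_pos (by simpa using hy))]
  linarith

lemma IsLyndonW.wordVal_lt {l p s : List (Fin (n+2))} (hl : IsLyndonW n l) (h : l = p ++ s)
    (hp : p ≠ []) (hs : s ≠ []) : wordVal n l < wordVal n s :=
  (wlt_iff_wordVal_lt _ _).1 (hl.2 p s h hp hs)

lemma IsLyndonW.wordIndex_lt_suffix {l p s : List (Fin (n+2))} (hl : IsLyndonW n l)
    (h : l = p ++ s) (hp : p ≠ []) (hs : s ≠ []) : wordIndex n l < wordIndex n s :=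
  wordIndex_lt_of_append_lt hl.1 hs <|
    wordVal_append_lt_append_of_length_le (hl.wordVal_lt h hp hs) (by simp [h]) _ _

lemma IsLyndonW.wordIndex_lt {f l : List (Fin (n+2))} (hf : IsLyndonW n f) (hl : IsLyndonW n l)
    (h : wordVal n f < wordVal n l) : wordIndex n f < wordIndex n l := by
  refine wordIndex_lt_of_append_lt hf.1 hl.1 ?_
  by_cases hp : f <+: l
  · obtain ⟨t, rfl⟩ := hp
    have ht : t ≠ [] := by
      rintro rfl
      simp at h
    rw [List.append_assoc, wordVal_append f (f ++ t), wordVal_append f (t ++ f)]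
    have := wordVal_append_lt_append_of_length_le (hl.wordVal_lt rfl hf.1 ht) (by simp) [] f
    rw [List.append_nil] at this
    exact add_lt_add_right (mul_lt_mul_of_pos_left this (pow_pos discount_pos _)) _
  · exact wordVal_append_lt_append h hp _ _

lemma IsLyndonW.wordIndex_le {f l : List (Fin (n+2))} (hf : IsLyndonW n f) (hl : IsLyndonW n l)
    (h : wordVal n f ≤ wordVal n l) : wordIndex n f ≤ wordIndex n l := by
  rcases h.lt_or_eq with h | h
  · exact (hf.wordIndex_lt hl h).le
  · rw [wordVal_injective h]

lemma IsLyndonW.wordIndex_mul_lt {l p s : List (Fin (n+2))} (hl : IsLyndonW n l) (h : l = p ++ s)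
    (hp : p ≠ []) (hs : s ≠ []) :
    wordIndex n l * (1 - discount n ^ s.length) < wordVal n s := by
  rw [← wordIndex_mul hs]
  exact mul_lt_mul_of_pos_right (hl.wordIndex_lt_suffix h hp hs)
    (one_sub_discount_pow_pos (by simpa using hs))

lemma IsLyndonW.wordIndex_mul_le {l s : List (Fin (n+2))} (hl : IsLyndonW n l) (h : s <:+ l) :
    wordIndex n l * (1 - discount n ^ s.length) ≤ wordVal n s := by
  obtain ⟨p, hp⟩ := h
  rcases eq_or_ne s [] with rfl | hs
  · simp [wordVal]
  rcases eq_or_ne p [] with rfl | hp'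
  · rw [List.nil_append] at hp
    rw [hp, wordIndex_mul hl.1]
  · exact (hl.wordIndex_mul_lt hp.symm hp' hs).le

end WordVal

/-- `IsShuffle x y z` says that `z` is obtained by interleaving `x` and `y`. -/
inductive IsShuffle {α : Type*} : List α → List α → List α → Prop
  | nil : IsShuffle [] [] []
  | left (i : α) {x y z : List α} (h : IsShuffle x y z) : IsShuffle (i :: x) y (i :: z)
  | right (j : α) {x y z : List α} (h : IsShuffle x y z) : IsShuffle x (j :: y) (j :: z)

/-- The discounted sum of the charges of a word with charged letters. -/
def chargeVal (n : ℕ) : List (Fin (n+2) × ℚ) → ℚ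
  | [] => 0
  | p :: v => (1 - discount n) * p.2 + discount n * chargeVal n v

/-- The charges of `v` are at most the indices of the suffixes of `s`. -/
def ChargesLe (n : ℕ) (s : List (Fin (n+2))) (v : List (Fin (n+2) × ℚ)) : Prop :=
  ∀ s₀, s₀ <:+ s → ∀ p ∈ v, p.2 * (1 - discount n ^ s₀.length) ≤ wordVal n s₀

/-- The charge of each suffix of `v` is at most its value. -/
def IsUndercharged (n : ℕ) (v : List (Fin (n+2) × ℚ)) : Prop :=
  ∀ v₀, v₀ <:+ v → chargeVal n v₀ ≤ wordVal n (v₀.map Prod.fst)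

/-- The concatenation of the words in `fs`, with letters charged by the index of their word. -/
def charges (n : ℕ) (fs : List (List (Fin (n+2)))) : List (Fin (n+2) × ℚ) :=
  fs.flatMap fun l => l.map fun i => (i, wordIndex n l)

section Leading

variable {n : ℕ}

lemma isShuffle_of_shCoef_ne_zero {x y z : List (Fin (n+2))} (h : shCoef n x y z ≠ 0) :
    IsShuffle x y z := by
  induction z generalizing x y with
  | nil =>
    have := length_eq_of_shCoef_ne_zero h
    obtain ⟨hx, hy⟩ : x = [] ∧ y = [] := by
      simpa [eq_comm (a := 0)] using this
    subst hx hy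
    exact .nil
  | cons k z ih =>
    rcases x with _ | ⟨i, x⟩
    · rcases y with _ | ⟨j, y⟩
      · simp [shCoef_nil_left] at h
      · obtain ⟨rfl, rfl⟩ : j = k ∧ y = z := by simpa [shCoef_nil_left] using h
        exact .right _ (ih (by simp [shCoef_nil_left]))
    · rcases y with _ | ⟨j, y⟩
      · obtain ⟨rfl, rfl⟩ : i = k ∧ x = z := by simpa [shCoef_nil_right] using h
        exact .left _ (ih (by simp [shCoef_nil_right]))
      · rw [shCoef_cons_cons] at h
        by_cases h1 : (if i = k then braidLeft n i (j :: y) * shCoef n x (j :: y) z else 0) = 0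
        · rw [h1, zero_add, ite_ne_right_iff] at h
          obtain ⟨rfl, h⟩ := h
          exact .right _ (ih h)
        · obtain ⟨rfl, h2⟩ := ite_ne_right_iff.1 h1
          exact .left _ (ih (right_ne_zero_of_mul h2))

lemma ChargesLe.mono {s s' : List (Fin (n+2))} {v v' : List (Fin (n+2) × ℚ)}
    (h : ChargesLe n s v) (hs : s' <:+ s) (hv : v' ⊆ v) : ChargesLe n s' v' :=
  fun s₀ h₀ p hp => h s₀ (h₀.trans hs) p (hv hp)

lemma IsUndercharged.mono {v v' : List (Fin (n+2) × ℚ)} (h : IsUndercharged n v)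
    (hv : v' <:+ v) : IsUndercharged n v' :=
  fun v₀ h₀ => h v₀ (h₀.trans hv)

lemma IsShuffle.wordVal_le {s z : List (Fin (n+2))} {v : List (Fin (n+2) × ℚ)}
    (h : IsShuffle s (v.map Prod.fst) z) (hs : ChargesLe n s v) (hv : IsUndercharged n v) :
    wordVal n z ≤ wordVal n s + wordVal n (v.map Prod.fst)
      - (1 - discount n ^ s.length) * chargeVal n v := by
  have hd := one_sub_discount_pow_nonneg (n := n) 1
  rw [pow_one] at hd
  generalize hy : v.map Prod.fst = y at h
  induction h generalizing v with
  | nil => simp [wordVal]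
  | @left i s y z h ih =>
    have h1 := mul_le_mul_of_nonneg_left (ih (hs.mono (List.suffix_cons _ _) (List.Subset.refl _))
      hv hy) (discount_pos (n := n)).le
    have h2 := mul_le_mul_of_nonneg_left (hv v List.suffix_rfl) hd
    rw [hy] at h2
    rw [wordVal, wordVal, List.length_cons, pow_succ]
    linarith
  | @right j s y z h ih =>
    rcases v with _ | ⟨p, v⟩
    · simp at hy
    obtain ⟨rfl, hvy⟩ : p.1 = j ∧ v.map Prod.fst = y := by simpa using hy
    have h1 := mul_le_mul_of_nonneg_left (ih (hs.mono List.suffix_rfl (List.subset_cons_self _ _))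
      (hv.mono (List.suffix_cons _ _)) hvy) (discount_pos (n := n)).le
    have h2 := mul_le_mul_of_nonneg_left (hs s List.suffix_rfl p List.mem_cons_self) hd
    rw [wordVal, wordVal, chargeVal]
    linarith

lemma IsShuffle.wordVal_cons_le_left {s z : List (Fin (n+2))} {v : List (Fin (n+2) × ℚ)}
    (h : IsShuffle s (v.map Prod.fst) z) (hs : ChargesLe n s v) (hv : IsUndercharged n v)
    (i : Fin (n+2)) :
    wordVal n (i :: z) ≤ wordVal n (i :: s) + discount n * wordVal n (v.map Prod.fst)
      - (discount n - discount n ^ (s.length + 1)) * chargeVal n v := by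
  have h1 := mul_le_mul_of_nonneg_left (h.wordVal_le hs hv) (discount_pos (n := n)).le
  rw [wordVal, wordVal, pow_succ]
  linarith

lemma IsShuffle.wordVal_cons_le_right {s z : List (Fin (n+2))} {v : List (Fin (n+2) × ℚ)}
    (h : IsShuffle s (v.map Prod.fst) z) (hs : ChargesLe n s v) (hv : IsUndercharged n v)
    (p : Fin (n+2) × ℚ) :
    wordVal n (p.1 :: z) ≤ discount n * wordVal n s + wordVal n ((p :: v).map Prod.fst)
      - (1 - discount n ^ s.length) * (chargeVal n (p :: v) - (1 - discount n) * p.2) := by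
  have h1 := mul_le_mul_of_nonneg_left (h.wordVal_le hs hv) (discount_pos (n := n)).le
  rw [wordVal, List.map_cons, wordVal, chargeVal]
  linarith

lemma chargeVal_map_append (r : List (Fin (n+2))) (g : ℚ) (v : List (Fin (n+2) × ℚ)) :
    chargeVal n (r.map (fun i => (i, g)) ++ v) =
      g * (1 - discount n ^ r.length) + discount n ^ r.length * chargeVal n v := by
  induction r with
  | nil => simp
  | cons i r ih =>
    rw [List.map_cons, List.cons_append, chargeVal, ih, List.length_cons, pow_succ]
    ring

lemma charges_cons (l : List (Fin (n+2))) (fs : List (List (Fin (n+2)))) :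
    charges n (l :: fs) = l.map (fun i => (i, wordIndex n l)) ++ charges n fs := rfl

lemma map_fst_charges (fs : List (List (Fin (n+2)))) :
    (charges n fs).map Prod.fst = fs.flatten := by
  induction fs with
  | nil => rfl
  | cons l fs ih => simp [charges_cons, ih, Function.comp_def]

lemma exists_of_mem_charges {fs : List (List (Fin (n+2)))} {p : Fin (n+2) × ℚ}
    (h : p ∈ charges n fs) : ∃ f ∈ fs, p.2 = wordIndex n f := by
  obtain ⟨f, hf, hp⟩ := List.mem_flatMap.1 h
  obtain ⟨i, -, rfl⟩ := List.mem_map.1 hp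
  exact ⟨f, hf, rfl⟩

lemma chargeVal_charges {fs : List (List (Fin (n+2)))} (h : ∀ f ∈ fs, IsLyndonW n f) :
    chargeVal n (charges n fs) = wordVal n fs.flatten := by
  induction fs with
  | nil => rfl
  | cons l fs ih =>
    rw [charges_cons, chargeVal_map_append, ih fun f hf => h f (List.mem_cons_of_mem _ hf),
      wordIndex_mul (h l List.mem_cons_self).1, List.flatten_cons, wordVal_append]

lemma IsUndercharged.map_append {l s : List (Fin (n+2))} (hl : IsLyndonW n l) (hs : s <:+ l)
    {v : List (Fin (n+2) × ℚ)} (hv : IsUndercharged n v) :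
    IsUndercharged n (s.map (fun i => (i, wordIndex n l)) ++ v) := by
  induction s with
  | nil => exact hv
  | cons i s ih =>
    intro v₀ h₀
    rw [List.map_cons, List.cons_append, List.suffix_cons_iff] at h₀
    rcases h₀ with rfl | h₀
    · rw [← List.cons_append, ← List.map_cons (f := fun i => (i, wordIndex n l)),
        chargeVal_map_append, List.map_append, wordVal_append]
      have h1 := hl.wordIndex_mul_le hs
      have h2 := mul_le_mul_of_nonneg_left (hv v List.suffix_rfl)
        (pow_nonneg (discount_pos (n := n)).le (i :: s).length)
      simpa [Function.comp_def] using add_le_add h1 h2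
    · exact ih ((List.suffix_cons _ _).trans hs) v₀ h₀

lemma isUndercharged_charges {fs : List (List (Fin (n+2)))} (h : ∀ f ∈ fs, IsLyndonW n f) :
    IsUndercharged n (charges n fs) := by
  induction fs with
  | nil =>
    intro v₀ h₀
    rw [List.suffix_nil.1 h₀]
    exact le_rfl
  | cons l fs ih =>
    exact (ih fun f hf => h f (List.mem_cons_of_mem _ hf)).map_append (h l List.mem_cons_self)
      List.suffix_rfl

lemma chargesLe_of_forall_le {l s : List (Fin (n+2))} (hl : IsLyndonW n l) (hs : s <:+ l)
    {v : List (Fin (n+2) × ℚ)} (h : ∀ p ∈ v, p.2 ≤ wordIndex n l) : ChargesLe n s v :=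
  fun _ h₀ p hp => (mul_le_mul_of_nonneg_right (h p hp) (one_sub_discount_pow_nonneg _)).trans
    (hl.wordIndex_mul_le (h₀.trans hs))

lemma charge_le_of_mem_charges {l : List (Fin (n+2))} (hl : IsLyndonW n l)
    {fs : List (List (Fin (n+2)))} (hf : ∀ f ∈ fs, IsLyndonW n f)
    (hle : ∀ f ∈ fs, wordVal n f ≤ wordVal n l) :
    ∀ p ∈ charges n fs, p.2 ≤ wordIndex n l := by
  intro p hp
  obtain ⟨f, hfs, h⟩ := exists_of_mem_charges hp
  rw [h]
  exact (hf f hfs).wordIndex_le hl (hle f hfs)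

lemma wordVal_le_append_flatten {l z : List (Fin (n+2))} (hl : IsLyndonW n l)
    {fs : List (List (Fin (n+2)))} (hf : ∀ f ∈ fs, IsLyndonW n f)
    (hle : ∀ f ∈ fs, wordVal n f ≤ wordVal n l) (h : IsShuffle l fs.flatten z) :
    wordVal n z ≤ wordVal n (l ++ fs.flatten) := by
  rw [← map_fst_charges] at h
  have := h.wordVal_le (chargesLe_of_forall_le hl List.suffix_rfl
    (charge_le_of_mem_charges hl hf hle)) (isUndercharged_charges hf)
  rw [chargeVal_charges hf, map_fst_charges] at this
  rw [wordVal_append]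
  linarith

lemma shCoef_append_eq_braidWord {s : List (Fin (n+2))} {v : List (Fin (n+2) × ℚ)}
    (hs : ChargesLe n s v) (hv : IsUndercharged n v)
    (hval : chargeVal n v = wordVal n (v.map Prod.fst))
    (hlt : ∀ s₀, s₀ <:+ s → s₀ ≠ [] → ∀ p ∈ v.head?,
      p.2 * (1 - discount n ^ s₀.length) < wordVal n s₀) :
    shCoef n s (v.map Prod.fst) (s ++ v.map Prod.fst) = braidWord n s (v.map Prod.fst) := by
  induction s with
  | nil => simp [shCoef_nil_left, braidWord]
  | cons i s ih =>
    rcases v with _ | ⟨p, v⟩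
    · simp [shCoef_nil_right, braidWord, braidLeft]
    · have hsuf : s <:+ i :: s := List.suffix_cons _ _
      have key : (if p.1 = i then shCoef n (i :: s) (v.map Prod.fst)
          (s ++ (p :: v).map Prod.fst) else 0) = 0 := by
        refine ite_eq_right_iff.2 fun hpi => ?_
        by_contra hne
        have h1 := (isShuffle_of_shCoef_ne_zero hne).wordVal_cons_le_right
          (hs.mono List.suffix_rfl (List.subset_cons_self _ _))
          (hv.mono (List.suffix_cons _ _)) p
        have h2 := hlt (i :: s) List.suffix_rfl (List.cons_ne_nil _ _) p rfl
        have h3 := mul_lt_mul_of_pos_left h2 (sub_pos.2 (discount_lt_one (n := n)))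
        rw [hpi, ← List.cons_append, wordVal_append, hval] at h1
        linarith
      rw [List.cons_append, List.map_cons, shCoef_cons_cons, ← List.map_cons, if_pos rfl, key,
        add_zero, braidWord_cons, ih (hs.mono hsuf (List.Subset.refl _))
          fun s₀ h₀ => hlt s₀ (h₀.trans hsuf)]

lemma shCoef_suffix_append {l p s : List (Fin (n+2))} (hl : IsLyndonW n l) (hps : l = p ++ s)
    (hp : p ≠ []) {fs : List (List (Fin (n+2)))} (hf : ∀ f ∈ fs, IsLyndonW n f)
    (hle : ∀ f ∈ fs, wordVal n f ≤ wordVal n l) :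
    shCoef n l (s ++ fs.flatten) (s ++ (l ++ fs.flatten)) =
      shCoef n l fs.flatten (l ++ fs.flatten) := by
  induction s generalizing p with
  | nil => rfl
  | cons i s ih =>
    have ih' := ih (p := p ++ [i]) (by simp [hps]) (by simp)
    have hsuf : i :: s <:+ l := ⟨p, hps.symm⟩
    have hmul := hl.wordIndex_mul_lt hps hp (List.cons_ne_nil _ _)
    rcases l with _ | ⟨a, l⟩
    · exact absurd rfl hl.1
    · have key : (if a = i then braidLeft n a (i :: (s ++ fs.flatten)) *
          shCoef n l (i :: (s ++ fs.flatten)) (s ++ (a :: l ++ fs.flatten)) else 0) = 0 := by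
        refine ite_eq_right_iff.2 fun hai => ?_
        by_contra hne
        set L := a :: l with hL
        set v := (i :: s).map (fun i => (i, wordIndex n L)) ++ charges n fs with hv
        have hvmap : v.map Prod.fst = i :: (s ++ fs.flatten) := by
          simp [hv, map_fst_charges, Function.comp_def]
        have hsh := isShuffle_of_shCoef_ne_zero (right_ne_zero_of_mul hne)
        rw [← hvmap] at hsh
        have hcharge : ∀ q ∈ v, q.2 ≤ wordIndex n L := by
          intro q hq
          rcases List.mem_append.1 hq with hq | hq
          · obtain ⟨j, -, rfl⟩ := List.mem_map.1 hq
            exact le_rfl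
          · exact charge_le_of_mem_charges hl hf hle q hq
        have h1 := hsh.wordVal_cons_le_left
          (chargesLe_of_forall_le hl (List.suffix_cons _ _) hcharge)
          ((isUndercharged_charges hf).map_append hl hsuf) a
        have h2 := mul_lt_mul_of_pos_left hmul (sub_pos.2 (discount_lt_one (n := n)))
        have h3 := wordIndex_mul hl.1
        rw [hvmap, hv, chargeVal_map_append, chargeVal_charges hf, ← hL, ← List.length_cons (a := a),
          ← hL, ← h3, hai, ← List.cons_append, ← List.cons_append, wordVal_append,
          wordVal_append, wordVal_append, ← h3] at h1
        linarith
      rw [List.cons_append (a := i), List.cons_append (a := i), shCoef_cons_cons, key,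
        zero_add, if_pos rfl, ih']

lemma shCoef_append_flatten_of_head?_lt {l s : List (Fin (n+2))} (hl : IsLyndonW n l)
    (hs : s <:+ l) {fs : List (List (Fin (n+2)))} (hf : ∀ f ∈ fs, IsLyndonW n f)
    (hle : ∀ f ∈ fs, wordVal n f ≤ wordVal n l)
    (hlt : ∀ f ∈ fs.head?, wordVal n f = wordVal n l → s.length < l.length) :
    shCoef n s fs.flatten (s ++ fs.flatten) = braidWord n s fs.flatten := by
  rw [← map_fst_charges]
  refine shCoef_append_eq_braidWord
    (chargesLe_of_forall_le hl hs (charge_le_of_mem_charges hl hf hle))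
    (isUndercharged_charges hf) (by rw [chargeVal_charges hf, map_fst_charges])
    fun s₀ h₀ hne p hp => ?_
  rcases fs with _ | ⟨f, fs⟩
  · simp [charges] at hp
  have hff := hf f List.mem_cons_self
  have hp : p.2 = wordIndex n f := by
    rcases f with _ | ⟨i, f⟩
    · exact absurd rfl hff.1
    · rw [charges_cons, List.map_cons, List.cons_append, List.head?_cons, Option.mem_some_iff] at hp
      rw [← hp]
  rw [hp]
  rcases (hle f List.mem_cons_self).lt_or_eq with h | h
  · exact (mul_lt_mul_of_pos_right (hff.wordIndex_lt hl h)
      (one_sub_discount_pow_pos (by simpa using hne))).trans_le (hl.wordIndex_mul_le (h₀.trans hs))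
  · rw [wordVal_injective h]
    obtain ⟨r, hr⟩ := h₀.trans hs
    refine hl.wordIndex_mul_lt hr.symm ?_ hne
    rintro rfl
    have h1 := hlt f rfl h
    have h2 := h₀.length_le
    rw [← hr, List.nil_append] at h1
    exact h1.not_ge h2

lemma exists_shCoef_append_flatten_eq {l : List (Fin (n+2))} (hl : IsLyndonW n l)
    {fs : List (List (Fin (n+2)))} (hf : ∀ f ∈ fs, IsLyndonW n f)
    (hle : ∀ f ∈ fs, wordVal n f ≤ wordVal n l) :
    ∃ c : Kq, c ≠ 0 ∧ ∃ m : ℕ, braidWord n l fs.flatten = c * braidWord n l l ^ m ∧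
      shCoef n l fs.flatten (l ++ fs.flatten) =
        c * ∑ k ∈ Finset.range (m + 1), braidWord n l l ^ k := by
  induction fs with
  | nil =>
    refine ⟨1, one_ne_zero, 0, by simp [braidWord, braidLeft], by simp [shCoef_nil_right]⟩
  | cons f fs ih =>
    rcases (hle f List.mem_cons_self).lt_or_eq with h | h
    · refine ⟨_, braidWord_ne_zero l (f :: fs).flatten, 0, by simp, ?_⟩
      rw [shCoef_append_flatten_of_head?_lt hl List.suffix_rfl hf hle
        fun g hg hgl => absurd hgl (by simp at hg; exact hg ▸ h.ne)]
      simp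
    · obtain rfl := wordVal_injective h
      have hf' : ∀ g ∈ fs, IsLyndonW n g := fun g hg => hf g (List.mem_cons_of_mem _ hg)
      have hle' : ∀ g ∈ fs, wordVal n g ≤ wordVal n f :=
        fun g hg => hle g (List.mem_cons_of_mem _ hg)
      obtain ⟨c, hc, m, h1, h2⟩ := ih hf' hle'
      refine ⟨c, hc, m + 1, ?_, ?_⟩
      · rw [List.flatten_cons, braidWord_append_right, h1]
        ring
      · rw [Finset.sum_range_succ, mul_add, ← h2]
        rcases f with _ | ⟨i, s⟩
        · exact absurd rfl hl.1
        set l := i :: s with hls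
        have h3 := shCoef_append_flatten_of_head?_lt hl (List.suffix_cons i s) hf hle
          fun _ _ _ => by simp [hls]
        have h4 := shCoef_suffix_append hl (p := [i]) hls (by simp) hf' hle'
        have h5 : c * braidWord n l l ^ (m + 1) = braidWord n l (l :: fs).flatten := by
          rw [List.flatten_cons, braidWord_append_right, h1]
          ring
        rw [h5, ← h4, hls, braidWord_cons, ← hls, ← h3]
        have h6 := shCoef_cons_cons i i i s (s ++ fs.flatten) (s ++ (l :: fs).flatten)
        rw [if_pos rfl, if_pos rfl] at h6
        exact h6.trans (add_comm _ _)

end Leading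

section NonVanishing

variable {n : ℕ}

lemma cart_eq_two_mul_sum (i j : Fin (n+2)) :
    cart n i j = 2 * ∑ k ∈ Finset.range (n+2),
      (((if k = i then 1 else 0) - (if k = i + 1 then 1 else 0)) *
        ((if k = j then 1 else 0) - (if k = j + 1 then 1 else 0)) : ℤ) := by
  have hi := i.2
  have hj := j.2
  simp only [sub_mul, mul_sub, ite_mul, one_mul, zero_mul, Finset.sum_sub_distrib,
    Finset.sum_ite_eq', Finset.mem_range, cart, Fin.ext_iff]
  split_ifs <;> omega

lemma sum_map_cart (l : List (Fin (n+2))) :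
    (l.map fun i => (l.map (cart n i)).sum).sum = 2 * ∑ k ∈ Finset.range (n+2),
      (l.map fun i : Fin (n+2) =>
        ((if k = i then 1 else 0) - (if k = i + 1 then 1 else 0) : ℤ)).sum ^ 2 := by
  have h (x y : List (Fin (n+2))) :
      (x.map fun i => (y.map (cart n i)).sum).sum = 2 * ∑ k ∈ Finset.range (n+2),
        (x.map fun i : Fin (n+2) =>
          ((if k = i then 1 else 0) - (if k = i + 1 then 1 else 0) : ℤ)).sum *
        (y.map fun i : Fin (n+2) =>
          ((if k = i then 1 else 0) - (if k = i + 1 then 1 else 0) : ℤ)).sum := by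
    induction x with
    | nil => simp
    | cons i x ih =>
      simp only [List.map_cons, List.sum_cons, ih, add_mul, Finset.sum_add_distrib, mul_add]
      congr 1
      clear ih
      induction y with
      | nil => simp
      | cons j y ih =>
        simp only [List.map_cons, List.sum_cons, ih, mul_add, Finset.sum_add_distrib,
          cart_eq_two_mul_sum i j]
  simp only [h, sq]

lemma sum_weighted_eq_length (l : List (Fin (n+2))) :
    ∑ k ∈ Finset.range (n+2), ((n : ℤ) + 2 - k) * (l.map fun i : Fin (n+2) =>
      ((if k = i then 1 else 0) - (if k = i + 1 then 1 else 0) : ℤ)).sum = l.length := by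
  induction l with
  | nil => simp
  | cons i l ih =>
    simp only [List.map_cons, List.sum_cons, mul_add, Finset.sum_add_distrib, ih, mul_sub,
      Finset.sum_sub_distrib, mul_ite, mul_one, mul_zero, Finset.sum_ite_eq', Finset.mem_range,
      List.length_cons]
    have hi := i.2
    split_ifs <;> push_cast <;> omega

lemma sum_map_cart_pos {l : List (Fin (n+2))} (hl : l ≠ []) :
    0 < (l.map fun i => (l.map (cart n i)).sum).sum := by
  rw [sum_map_cart]
  refine mul_pos two_pos ((Finset.sum_nonneg fun _ _ => sq_nonneg _).lt_of_ne' fun h => hl ?_)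
  rw [Finset.sum_eq_zero_iff_of_nonneg fun _ _ => sq_nonneg _] at h
  have := sum_weighted_eq_length l
  rw [Finset.sum_eq_zero fun k hk => by rw [pow_eq_zero_iff two_ne_zero |>.1 (h k hk), mul_zero]]
    at this
  simpa [eq_comm (a := (0 : ℤ))] using this

lemma braidWord_sq (x y : List (Fin (n+2))) :
    braidWord n x y ^ 2 = qX ^ (-2 * (x.map fun i => (y.map (cart n i)).sum).sum) := by
  have hb (i j : Fin (n+2)) : braid n i j ^ 2 = qX ^ (-2 * cart n i j) := by
    rw [braid, mul_pow, ← pow_mul, mul_comm _ 2, pow_mul, neg_one_sq, one_pow, one_mul,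
      ← zpow_natCast, ← zpow_mul]
    congr 1
    push_cast
    ring
  have hl (i : Fin (n+2)) : braidLeft n i y ^ 2 = qX ^ (-2 * (y.map (cart n i)).sum) := by
    induction y with
    | nil => simp [braidLeft]
    | cons j y ih =>
      rw [braidLeft_cons, mul_pow, hb, ih, ← zpow_add₀ qX_ne_zero, List.map_cons, List.sum_cons,
        mul_add]
  induction x with
  | nil => simp [braidWord]
  | cons i x ih =>
    rw [braidWord_cons, mul_pow, hl, ih, ← zpow_add₀ qX_ne_zero, List.map_cons, List.sum_cons,
      mul_add]

lemma qX_pow_ne_one {k : ℕ} (hk : k ≠ 0) : qX ^ k ≠ 1 := by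
  intro h
  have h1 : algebraMap (Polynomial ℚ) (RatFunc ℚ) (Polynomial.X ^ k) =
      algebraMap (Polynomial ℚ) (RatFunc ℚ) 1 := by
    rw [map_pow, map_one, RatFunc.algebraMap_X]
    exact h
  have h2 := congrArg Polynomial.natDegree (RatFunc.algebraMap_injective ℚ h1)
  rw [Polynomial.natDegree_X_pow, Polynomial.natDegree_one] at h2
  exact hk h2

lemma sum_braidWord_pow_ne_zero {l : List (Fin (n+2))} (hl : l ≠ []) (m : ℕ) :
    ∑ k ∈ Finset.range (m + 1), braidWord n l l ^ k ≠ 0 := by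
  intro h
  have h1 := geom_sum_mul (braidWord n l l) (m + 1)
  rw [h, zero_mul, eq_comm, sub_eq_zero] at h1
  have h2 := congrArg (· ^ 2) h1
  obtain ⟨N, hN⟩ := Int.eq_ofNat_of_zero_le (sum_map_cart_pos hl).le
  have hN0 : N ≠ 0 := by
    rintro rfl
    exact (sum_map_cart_pos hl).ne' hN
  simp only [one_pow] at h2
  rw [← pow_mul, mul_comm, pow_mul, braidWord_sq, hN, neg_mul, zpow_neg, inv_pow, inv_eq_one] at h2
  refine qX_pow_ne_one (k := 2 * N * (m + 1)) (by positivity) ?_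
  rw [pow_mul, ← h2, ← zpow_natCast qX]
  push_cast
  rfl

end NonVanishing

section Dominant

variable {n : ℕ}

lemma exists_isShuffle {α : Type*} (x y : List α) : ∃ z, IsShuffle x y z := by
  induction x with
  | nil =>
    induction y with
    | nil => exact ⟨_, .nil⟩
    | cons j y ih => exact ⟨_, .right j ih.choose_spec⟩
  | cons i x ih => exact ⟨_, .left i ih.choose_spec⟩

lemma IsShuffle.exists_dominating {x' y' z' : List (Fin (n+2))} (h : IsShuffle x' y' z')
    {x y : List (Fin (n+2))} (hxl : x'.length = x.length) (hyl : y'.length = y.length)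
    (hx : wordVal n x' ≤ wordVal n x) (hy : wordVal n y' ≤ wordVal n y) :
    ∃ z, IsShuffle x y z ∧ (wordVal n z' < wordVal n z ∨ z' = z ∧ x' = x ∧ y' = y) := by
  induction h generalizing x y with
  | nil =>
    obtain rfl := List.length_eq_zero_iff.1 hxl.symm
    obtain rfl := List.length_eq_zero_iff.1 hyl.symm
    exact ⟨[], .nil, .inr ⟨rfl, rfl, rfl⟩⟩
  | @left i x' y' z' h ih =>
    rcases x with _ | ⟨k, x⟩
    · simp at hxl
    rcases lt_trichotomy i k with hik | rfl | hik
    · obtain ⟨z, hz⟩ := exists_isShuffle x y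
      exact ⟨_, .left k hz, .inl (wordVal_cons_lt_cons_of_lt hik _ _)⟩
    · obtain ⟨z, hz, hlt⟩ := ih (Nat.succ_injective hxl) hyl
        ((wordVal_cons_le_cons_iff i _ _).1 hx) hy
      refine ⟨_, .left i hz, hlt.imp (wordVal_cons_lt_cons_iff i _ _).2 ?_⟩
      rintro ⟨rfl, rfl, rfl⟩
      exact ⟨rfl, rfl, rfl⟩
    · exact absurd hx (wordVal_cons_lt_cons_of_lt hik _ _).not_ge
  | @right j x' y' z' h ih =>
    rcases y with _ | ⟨k, y⟩
    · simp at hyl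
    rcases lt_trichotomy j k with hjk | rfl | hjk
    · obtain ⟨z, hz⟩ := exists_isShuffle x y
      exact ⟨_, .right k hz, .inl (wordVal_cons_lt_cons_of_lt hjk _ _)⟩
    · obtain ⟨z, hz, hlt⟩ := ih hxl (Nat.succ_injective hyl) hx
        ((wordVal_cons_le_cons_iff j _ _).1 hy)
      refine ⟨_, .right j hz, hlt.imp (wordVal_cons_lt_cons_iff j _ _).2 ?_⟩
      rintro ⟨rfl, rfl, rfl⟩
      exact ⟨rfl, rfl, rfl⟩
    · exact absurd hy (wordVal_cons_lt_cons_of_lt hjk _ _).not_ge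

lemma isMaxWord_iff {u : F n} {w : List (Fin (n+2))} :
    IsMaxWord n u w ↔ u w ≠ 0 ∧ ∀ x, u x ≠ 0 → wordVal n x ≤ wordVal n w := by
  simp only [IsMaxWord, eq_or_wlt_iff, Finsupp.mem_support_iff]

lemma IsDominant.exists_homogeneous {w : List (Fin (n+2))} (h : IsDominant n w) :
    ∃ u ∈ Ualg n, u w ≠ 0 ∧
      ∀ x, u x ≠ 0 → x.length = w.length ∧ wordVal n x ≤ wordVal n w := by
  obtain ⟨u, hu, hw⟩ := h
  rw [isMaxWord_iff] at hw
  refine ⟨lengthPart n w.length u, lengthPart_mem_Ualg _ hu, ?_, fun x hx => ?_⟩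
  · rw [lengthPart_apply, if_pos rfl]
    exact hw.1
  · rw [lengthPart_apply, ite_ne_right_iff] at hx
    exact ⟨hx.1, hw.2 x hx.2⟩

lemma IsDominant.of_append_append {a x b : List (Fin (n+2))} (h : IsDominant n (a ++ x ++ b)) :
    IsDominant n x := by
  have hfirst {u : F n} (hu : u ∈ Ualg n) : ∃ v ∈ Ualg n, ∀ z, v z = u (a ++ z) := by
    clear h
    induction a generalizing u with
    | nil => exact ⟨u, hu, fun _ => rfl⟩
    | cons k a ih => exact ih (removeFirst_mem_Ualg k hu)
  have hlast {u : F n} (hu : u ∈ Ualg n) : ∃ v ∈ Ualg n, ∀ z, v z = u (z ++ b) := by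
    clear h
    induction b using List.reverseRecOn generalizing u with
    | nil => exact ⟨u, hu, fun _ => by rw [List.append_nil]⟩
    | append_singleton b k ih =>
      obtain ⟨v, hv, h⟩ := ih (removeLast_mem_Ualg k hu)
      exact ⟨v, hv, fun z => by rw [h, removeLast_apply, List.append_assoc]⟩
  obtain ⟨u, hu, hne, hmax⟩ := h.exists_homogeneous
  obtain ⟨v, hv, hvu⟩ := hlast hu
  obtain ⟨r, hr, hrv⟩ := hfirst hv
  refine ⟨r, hr, isMaxWord_iff.2 ⟨by rwa [hrv, hvu], fun z hz => ?_⟩⟩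
  rw [hrv, hvu] at hz
  obtain ⟨h1, h2⟩ := hmax _ hz
  exact wordVal_le_of_append_le_append (by simpa using h1) h2

lemma IsDominant.append_flatten {l : List (Fin (n+2))} (hl : IsLyndonW n l)
    {fs : List (List (Fin (n+2)))} (hf : ∀ f ∈ fs, IsLyndonW n f)
    (hle : ∀ f ∈ fs, wordVal n f ≤ wordVal n l) (hdl : IsDominant n l)
    (hdf : IsDominant n fs.flatten) : IsDominant n (l ++ fs.flatten) := by
  obtain ⟨u, hu, hul, humax⟩ := hdl.exists_homogeneous
  obtain ⟨v, hv, hvw, hvmax⟩ := hdf.exists_homogeneous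
  have key {x y z : List (Fin (n+2))} (hx : u x ≠ 0) (hy : v y ≠ 0) (hz : shCoef n x y z ≠ 0) :
      wordVal n z ≤ wordVal n (l ++ fs.flatten) ∧
        (z = l ++ fs.flatten → x = l ∧ y = fs.flatten) := by
    obtain ⟨z', hz', h⟩ := (isShuffle_of_shCoef_ne_zero hz).exists_dominating
      (humax x hx).1 (hvmax y hy).1 (humax x hx).2 (hvmax y hy).2
    have hle' := wordVal_le_append_flatten hl hf hle hz'
    rcases h with h | ⟨rfl, h⟩
    · exact ⟨h.le.trans hle', fun heq => absurd (heq ▸ h) hle'.not_gt⟩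
    · exact ⟨hle', fun _ => h⟩
  refine ⟨shuffle n u v, shuffle_mem_Ualg hu hv, isMaxWord_iff.2 ⟨?_, fun z hz => ?_⟩⟩
  · have hc : shCoef n l fs.flatten (l ++ fs.flatten) ≠ 0 := by
      obtain ⟨c, hc, m, -, h⟩ := exists_shCoef_append_flatten_eq hl hf hle
      rw [h]
      exact mul_ne_zero hc (sum_braidWord_pow_ne_zero hl.1 m)
    rw [shuffle_apply, Finsupp.sum, Finset.sum_eq_single l, Finsupp.sum,
      Finset.sum_eq_single fs.flatten]
    · exact mul_ne_zero (mul_ne_zero hul hvw) hc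
    · intro y hy hne
      by_contra h
      exact hne ((key hul (Finsupp.mem_support_iff.1 hy) (right_ne_zero_of_mul h)).2 rfl).2
    · intro h
      exact absurd (Finsupp.mem_support_iff.2 hvw) h
    · intro x hx hne
      refine Finset.sum_eq_zero fun y hy => ?_
      by_contra h
      exact hne ((key (Finsupp.mem_support_iff.1 hx) (Finsupp.mem_support_iff.1 hy)
        (right_ne_zero_of_mul h)).2 rfl).1
    · intro h
      exact absurd (Finsupp.mem_support_iff.2 hul) h
  · rw [shuffle_apply] at hz
    obtain ⟨x, hx, hz⟩ := Finset.exists_ne_zero_of_sum_ne_zero hz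
    obtain ⟨y, hy, hz⟩ := Finset.exists_ne_zero_of_sum_ne_zero hz
    exact (key (Finsupp.mem_support_iff.1 hx) (Finsupp.mem_support_iff.1 hy)
      (right_ne_zero_of_mul hz)).1

lemma isDominant_nil : IsDominant n [] := by
  refine ⟨prodLetters n [], prodLetters_mem_Ualg _, isMaxWord_iff.2 ⟨by simp [prodLetters], ?_⟩⟩
  intro x hx
  rw [prodLetters, Finsupp.single_apply_ne_zero] at hx
  rw [hx.1]

end Dominant

/-- Let `𝐢 = 𝐢₁𝐢₂⋯𝐢_d` be the canonical (Chen–Fox–Lyndon)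
factorization of a word into a non-increasing concatenation of Lyndon words
`𝐢₁ ⪰ 𝐢₂ ⪰ ⋯ ⪰ 𝐢_d`.  Then `𝐢` is dominant if and only if every factor `𝐢_s` is
a dominant (Lyndon) word. -/
theorem stmt7 (n : ℕ) (fs : List (List (Fin (n+2))))
    (hLyn : ∀ f ∈ fs, IsLyndonW n f)
    (hSort : fs.Chain' (fun a b => b = a ∨ wlt n b a)) :
    IsDominant n fs.flatten ↔ ∀ f ∈ fs, IsDominant n f := by
  have hSort' : fs.Pairwise fun a b => wordVal n b ≤ wordVal n a := by
    simp only [eq_or_wlt_iff] at hSort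
    have : IsTrans (List (Fin (n+2))) fun a b => wordVal n b ≤ wordVal n a :=
      ⟨fun _ _ _ h₁ h₂ => h₂.trans h₁⟩
    exact List.isChain_iff_pairwise.1 hSort
  clear hSort
  constructor
  · intro h f hf
    obtain ⟨r, t, rfl⟩ := List.append_of_mem hf
    refine IsDominant.of_append_append (a := r.flatten) (b := t.flatten) ?_
    rwa [List.flatten_append, List.flatten_cons, ← List.append_assoc] at h
  · intro h
    induction fs with
    | nil => exact isDominant_nil
    | cons l fs ih =>
      simp only [List.mem_cons, forall_eq_or_imp, List.pairwise_cons] at hLyn hSort' h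
      exact h.1.append_flatten hLyn.1 hLyn.2 hSort'.1 (ih hLyn.2 hSort'.2 h.2)

end SpinQHA
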